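/- arXiv:1210.0233 — 2 statements merged into one kernel-verified Lean document; each statement's English description precedes it below -/
import Mathlib

section
/- Let k be a field, let R be a finitely generated commutative k-algebra of Krull dimension d, and let M be a finitely generated projective R-module of rank r. Then M is generated over R by d + r elements, i.e., there exists a subset of M of cardinality at most d + r whose R-linear span is all of M. -/
/-- An `R`-module `M` is generated by `n` elements if there is a subset of `M` of
cardinality at most `n` whose `R`-linear span is all of `M`. -/
def Module.GeneratedBy (R : Type*) [CommRing R] (M : Type*) [AddCommGroup M]
    [Module R M] (n : ℕ) : Prop :=
  ∃ s : Finset M, s.card ≤ n ∧ Submodule.span R (s : Set M) = ⊤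

/-- A module over a commutative ring has rank `r` if its localization at every
prime ideal `p` is a free module of rank `r` over the localized ring. -/
def Module.HasProjectiveRank (R : Type*) [CommRing R] (M : Type*) [AddCommGroup M]
    [Module R M] (r : ℕ) : Prop :=
  ∀ (p : Ideal R) [p.IsPrime],
    Module.Free (Localization.AtPrime p) (LocalizedModule p.primeCompl M) ∧
    Module.finrank (Localization.AtPrime p) (LocalizedModule p.primeCompl M) = r

open TensorProduct

/-- Given finitely many primes at which the fibers of a module are nonzero, some element of the
module is nonzero in all of these fibers. -/
theorem Module.exists_forall_tmul_ne_zero {R N : Type*} [CommRing R] [AddCommGroup N] [Module R N]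
    (T : Finset (PrimeSpectrum R))
    (hT : ∀ p ∈ T, Nontrivial (p.asIdeal.Fiber N)) :
    ∃ m : N, ∀ p ∈ T, (1 ⊗ₜ m : p.asIdeal.Fiber N) ≠ 0 := by
  classical
  induction h : T.card generalizing T with
  | zero => exact ⟨0, by simp [Finset.card_eq_zero.mp h]⟩
  | succ n ih =>
    obtain ⟨p, hp⟩ := T.exists_minimal (Finset.card_pos.mp (by omega))
    obtain ⟨m, hm⟩ := ih (T.erase p) (fun q hq ↦ hT q (Finset.mem_of_mem_erase hq))
      (by rw [Finset.card_erase_of_mem hp.1, h, Nat.add_sub_cancel])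
    by_cases hpm : (1 ⊗ₜ m : p.asIdeal.Fiber N) = 0
    · have := hT p hp.1
      obtain ⟨y, hy⟩ := exists_ne (0 : p.asIdeal.Fiber N)
      obtain ⟨x, hx⟩ : ∃ x : N, (1 ⊗ₜ x : p.asIdeal.Fiber N) ≠ 0 := by
        by_contra! h0
        refine hy ?_
        induction y using TensorProduct.induction_on with
        | zero => rfl
        | add a b ha hb => grind
        | tmul a b => rw [← mul_one a, ← smul_eq_mul, ← smul_tmul', h0, smul_zero]
      obtain ⟨a, haq, hap⟩ : ∃ a ∈ (T.erase p).inf PrimeSpectrum.asIdeal, a ∉ p.asIdeal := by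
        rw [← SetLike.not_le_iff_exists, p.isPrime.inf_le']
        rintro ⟨q, hq, hqp⟩
        exact (Finset.ne_of_mem_erase hq)
          (le_antisymm hqp (hp.2 (Finset.mem_of_mem_erase hq) hqp))
      have key (q : PrimeSpectrum R) : (1 ⊗ₜ (m + a • x) : q.asIdeal.Fiber N) =
          1 ⊗ₜ m + algebraMap R q.asIdeal.ResidueField a • (1 ⊗ₜ x) := by
        rw [tmul_add, tmul_smul, algebraMap_smul]
      refine ⟨m + a • x, fun q hq ↦ ?_⟩
      rw [key]
      by_cases hqp : q = p
      · subst hqp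
        rw [hpm, zero_add]
        exact smul_ne_zero (by simpa using hap) hx
      · have hq' := Finset.mem_erase.mpr ⟨hqp, hq⟩
        have : algebraMap R q.asIdeal.ResidueField a = 0 := by
          simpa using Finset.inf_le (f := PrimeSpectrum.asIdeal) hq' haq
        simpa [this] using hm q hq'
    · exact ⟨m, fun q hq ↦ if hqp : q = p then hqp ▸ hpm else hm q (by simp [*])⟩

/-- The dimension of the fiber of a module at a prime. -/
noncomputable def Module.fiberRank {R : Type*} (N : Type*) [CommRing R] [AddCommGroup N]
    [Module R N] (p : PrimeSpectrum R) : ℕ :=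
  Module.finrank p.asIdeal.ResidueField (p.asIdeal.Fiber N)

namespace Module

variable {R N : Type*} [CommRing R] [AddCommGroup N] [Module R N]

theorem baseChange_mkQ_surjective (A : Type*) [CommRing A] [Algebra R A] (P : Submodule R N) :
    Function.Surjective (P.mkQ.baseChange A) :=
  LinearMap.lTensor_surjective A P.mkQ_surjective

theorem fiberRank_quotient_le [Module.Finite R N] (P : Submodule R N) (p : PrimeSpectrum R) :
    fiberRank (N ⧸ P) p ≤ fiberRank N p :=
  LinearMap.finrank_le_finrank_of_surjective (baseChange_mkQ_surjective _ P)

theorem fiberRank_quotient_lt [Module.Finite R N] {P : Submodule R N} {p : PrimeSpectrum R}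
    {m : N} (hm : m ∈ P) (h : (1 ⊗ₜ m : p.asIdeal.Fiber N) ≠ 0) :
    fiberRank (N ⧸ P) p < fiberRank N p := by
  let f := P.mkQ.baseChange p.asIdeal.ResidueField
  have h1 := f.finrank_range_add_finrank_ker
  rw [LinearMap.range_eq_top.mpr (baseChange_mkQ_surjective _ P), finrank_top] at h1
  have h2 : 0 < finrank p.asIdeal.ResidueField (LinearMap.ker f) := by
    have hmf : (1 ⊗ₜ m : p.asIdeal.Fiber N) ∈ LinearMap.ker f := by
      simp [f, (Submodule.Quotient.mk_eq_zero P).mpr hm]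
    have : Nontrivial (LinearMap.ker f) :=
      nontrivial_of_ne (⟨1 ⊗ₜ m, hmf⟩ : LinearMap.ker f) 0 (by simpa using h)
    exact Module.finrank_pos (R := p.asIdeal.ResidueField) (M := LinearMap.ker f)
  exact (Nat.lt_add_of_pos_right h2).trans_eq h1

theorem fiberRank_pos_iff [Module.Finite R N] {p : PrimeSpectrum R} :
    0 < fiberRank N p ↔ p ∈ support R N := by
  rw [mem_support_iff_nontrivial_residueField_tensorProduct, fiberRank, finrank_pos_iff]

theorem subsingleton_baseChange_quotient_iff (A : Type*) [CommRing A] [Algebra R A]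
    (P : Submodule R N) : Subsingleton (A ⊗[R] (N ⧸ P)) ↔ P.baseChange A = ⊤ := by
  have hker : LinearMap.ker (P.mkQ.baseChange A) = P.baseChange A :=
    SetLike.ext fun x ↦ lTensor_exact A (LinearMap.exact_subtype_mkQ P) P.mkQ_surjective x
  rw [← hker, LinearMap.ker_eq_top]
  refine ⟨fun _ ↦ Subsingleton.elim _ _, fun h ↦ ?_⟩
  rw [subsingleton_iff_forall_eq 0]
  intro y
  obtain ⟨x, rfl⟩ := baseChange_mkQ_surjective A P y
  rw [h, LinearMap.zero_apply]

theorem fiberRank_le_iff [Module.Finite R N] {p : PrimeSpectrum R} {c : ℕ} :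
    fiberRank N p ≤ c ↔
      ∃ s : Finset N, s.card ≤ c ∧ p ∉ support R (N ⧸ Submodule.span R (s : Set N)) := by
  classical
  simp_rw [mem_support_iff_nontrivial_residueField_tensorProduct, not_nontrivial_iff_subsingleton,
    subsingleton_baseChange_quotient_iff, Submodule.baseChange_span]
  constructor
  · intro h
    obtain ⟨κ, a, ha, hsp, hli⟩ := exists_linearIndependent' p.asIdeal.ResidueField
      (fun x : N ↦ (1 ⊗ₜ x : p.asIdeal.Fiber N))
    have := hli.finite
    have := Fintype.ofFinite κ
    refine ⟨Finset.univ.image a, ?_, ?_⟩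
    · exact Finset.card_image_le.trans (hli.fintype_card_le_finrank.trans h)
    · rw [Finset.coe_image, Finset.coe_univ, Set.image_univ, ← Set.range_comp]
      have := Submodule.baseChange_top (R := R) (M := N) p.asIdeal.ResidueField
      rw [← this, ← Submodule.span_univ, Submodule.baseChange_span, Set.image_univ]
      exact hsp
  · rintro ⟨s, hs, h⟩
    refine le_trans ?_ hs
    have := finrank_span_finset_le_card (R := p.asIdeal.ResidueField)
      (s.image (fun x : N ↦ (1 ⊗ₜ x : p.asIdeal.Fiber N)))
    rw [Set.finrank, Finset.coe_image] at this
    rw [fiberRank, ← finrank_top, ← h]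
    exact this.trans Finset.card_image_le

theorem isOpen_setOf_fiberRank_le [Module.Finite R N] (c : ℕ) :
    IsOpen {p : PrimeSpectrum R | fiberRank N p ≤ c} := by
  simp_rw [fiberRank_le_iff, Set.ofPred_exists, Set.ofPred_and]
  exact isOpen_iUnion fun s ↦ isOpen_const.inter isClosed_support.isOpen_compl

theorem _root_.PrimeSpectrum.finite_setOf_minimal [IsNoetherianRing R] {Z : Set (PrimeSpectrum R)}
    (hZ : IsClosed Z) : {p | Minimal (· ∈ Z) p}.Finite := by
  obtain ⟨I, rfl⟩ := (PrimeSpectrum.isClosed_iff_zeroLocus_ideal _).mp hZ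
  refine .of_finite_image (f := PrimeSpectrum.asIdeal) (.subset
    (I.finite_minimalPrimes_of_isNoetherianRing R) ?_) fun _ _ _ _ ↦ PrimeSpectrum.ext
  rintro _ ⟨p, hp, rfl⟩
  exact ⟨⟨p.isPrime, hp.1⟩, fun q hq hqp ↦ hp.2 (y := ⟨q, hq.1⟩) hq.2 hqp⟩

/-- **Forster–Swan theorem**: a finite module over a Noetherian ring is generated by `n` elements
if, for every prime `p` in its support, the dimension of its fiber at `p` plus the dimension of
`R ⧸ p` is at most `n`. -/
theorem generatedBy_of_fiberRank_add_coheight_le [IsNoetherianRing R] [Module.Finite R N]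
    (n : ℕ) (h : ∀ p : PrimeSpectrum R, 0 < fiberRank N p →
      (fiberRank N p : ℕ∞) + Order.coheight p ≤ n) : GeneratedBy R N n := by
  classical
  induction n generalizing N with
  | zero =>
    have : Subsingleton N := by
      rw [← support_eq_empty_iff (R := R), Set.eq_empty_iff_forall_notMem]
      intro p hp
      rw [← fiberRank_pos_iff] at hp
      have := le_self_add.trans (h p hp)
      norm_cast at this
      omega
    exact ⟨∅, by simp, Subsingleton.elim _ _⟩
  | succ n ih =>
    let T : Set (PrimeSpectrum R) :=
      {p | 0 < fiberRank N p ∧ (fiberRank N p : ℕ∞) + Order.coheight p = (n + 1 : ℕ)}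
    have hTle (p) (hp : p ∈ T) : fiberRank N p ≤ n + 1 := by
      have := le_self_add.trans hp.2.le
      exact_mod_cast this
    have hT : T.Finite := by
      refine ((Set.finite_Iic (n + 1)).biUnion fun c _ ↦ PrimeSpectrum.finite_setOf_minimal
        (isOpen_setOf_fiberRank_le (R := R) (N := N) c).isClosed_compl).subset fun p hp ↦ ?_
      obtain ⟨c, hc⟩ := Nat.exists_eq_add_of_lt hp.1
      rw [Nat.zero_add] at hc
      refine Set.mem_biUnion (x := c) (by have := hTle p hp; simp; omega) ⟨by simp; omega, ?_⟩
      intro q hq hqp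
      by_contra hpq
      simp only [Set.mem_compl_iff, Set.mem_ofPred_eq, not_le] at hq
      have hlt : q < p := lt_of_le_not_ge hqp hpq
      have h1 := Order.coheight_add_one_le hlt
      have h2 := h q (by omega)
      have h3 : (fiberRank N p : ℕ∞) ≤ fiberRank N q := by exact_mod_cast (by omega)
      have h4 := (add_le_add h3 h1).trans h2
      rw [← add_assoc, hp.2] at h4
      norm_cast at h4
      omega
    obtain ⟨m, hm⟩ := exists_forall_tmul_ne_zero (N := N) hT.toFinset (fun p hp ↦ by
      rw [← mem_support_iff_nontrivial_residueField_tensorProduct, ← fiberRank_pos_iff]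
      exact (hT.mem_toFinset.mp hp).1)
    let P := Submodule.span R {m}
    obtain ⟨s, hs, hsp⟩ := ih (N := N ⧸ P) (fun p hp ↦ by
      have hle := fiberRank_quotient_le P p
      have hp' := hp.trans_le hle
      by_cases hpT : p ∈ T
      · have hlt := fiberRank_quotient_lt (P := P) (Submodule.mem_span_singleton_self m)
          (hm p (hT.mem_toFinset.mpr hpT))
        have h1 : ((fiberRank (N ⧸ P) p : ℕ∞) + 1) ≤ fiberRank N p := by
          exact_mod_cast hlt
        have h2 := (add_le_add_left h1 (Order.coheight p)).trans hpT.2.le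
        rw [add_right_comm] at h2
        push_cast at h2
        exact (ENat.add_le_add_iff_right ENat.one_ne_top).mp h2
      · have h1 := lt_of_le_of_ne (h p hp') fun h2 ↦ hpT ⟨hp', h2⟩
        have h2 : (fiberRank N p : ℕ∞) + Order.coheight p ≤ n := by
          push_cast at h1
          exact Order.le_of_lt_add_one h1
        exact (add_le_add_left (by exact_mod_cast hle) _).trans h2)
    refine ⟨insert m (s.image Quotient.out), (Finset.card_insert_le _ _).trans
      (Nat.add_le_add_right (Finset.card_image_le.trans hs) 1), ?_⟩
    have himg : P.mkQ '' (Quotient.out '' (s : Set (N ⧸ P))) = s := by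
      rw [Set.image_image]
      exact (Set.image_congr fun x _ ↦ Quotient.out_eq x).trans (Set.image_id _)
    rw [Finset.coe_insert, Finset.coe_image, Submodule.span_insert]
    have := congrArg (Submodule.comap P.mkQ) hsp
    rwa [← himg, Submodule.span_image, Submodule.comap_map_mkQ, Submodule.comap_top] at this

theorem HasProjectiveRank.fiberRank_eq {r : ℕ} [Module.Finite R N] [Module.Projective R N]
    (hr : HasProjectiveRank R N r) (p : PrimeSpectrum R) : fiberRank N p = r := by
  rw [fiberRank, ← rankAtStalk_eq]
  exact (hr p.asIdeal).2

end Module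

/-- Forster–Swan: a finitely generated projective module of rank `r` over a
finitely generated commutative algebra of Krull dimension `d` over a field is
generated by `d + r` elements. -/
theorem forster_swan (k : Type*) [Field k] (R : Type*) [CommRing R] [Algebra k R]
    (hfg : Algebra.FiniteType k R) (d : ℕ) (hd : ringKrullDim R = (d : WithBot ℕ∞))
    (M : Type*) [AddCommGroup M] [Module R M]
    (hM : Module.Finite R M) (hP : Module.Projective R M)
    (r : ℕ) (hr : Module.HasProjectiveRank R M r) :
    Module.GeneratedBy R M (d + r) := by
  have : IsNoetherianRing R := Algebra.FiniteType.isNoetherianRing k R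
  refine Module.generatedBy_of_fiberRank_add_coheight_le (d + r) fun p _ ↦ ?_
  have hp : Order.coheight p ≤ d := by
    exact_mod_cast (Order.coheight_le_krullDim p).trans hd.le
  rw [hr.fiberRank_eq, add_comm, Nat.cast_add]
  gcongr
end

section
/- Let A be a commutative integral domain that is a finitely generated ℂ-algebra, and let (I_n)_{n ∈ ℕ} be a countable family of nonzero ideals of A. Then there exists a ℂ-algebra homomorphism φ : A → ℂ such that for every n, the ideal I_n is not contained in the kernel of φ. -/
open Cardinal in
theorem Algebra.IsAlgebraic.of_rank_le_aleph0 (k L : Type*) [Field k] [Field L] [Algebra k L]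
    [Uncountable k] (h : Module.rank k L ≤ ℵ₀) : Algebra.IsAlgebraic k L := by
  refine ⟨fun x => ?_⟩
  by_contra hx
  have hle := (Transcendental.linearIndependent_sub_inv hx).cardinal_lift_le_rank
  have hk : ℵ₀ < #k := aleph0_lt_mk
  have h1 := hle.trans (lift_le.2 h)
  rw [lift_aleph0, lift_le_aleph0] at h1
  exact absurd hk h1.not_gt

open Cardinal in
theorem MvPolynomial.rank_le_aleph0_of_surjective {k L σ : Type*} [Field k] [CommRing L]
    [Algebra k L] [Countable σ] (f : MvPolynomial σ k →ₐ[k] L) (hf : Function.Surjective f) :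
    Module.rank k L ≤ ℵ₀ := by
  have h := LinearMap.lift_rank_le_of_surjective f.toLinearMap hf
  rw [MvPolynomial.rank_eq_lift] at h
  have h1 : #(σ →₀ ℕ) ≤ ℵ₀ := mk_le_aleph0
  have h2 := h.trans (lift_le.2 (lift_le.2 h1))
  simpa using h2

/-- Over an uncountable algebraically closed field, countably many nonzero elements of a finitely
generated domain are simultaneously nonzero at some rational point. -/
theorem Algebra.FiniteType.exists_algHom_forall_ne_zero {k A ι : Type*} [Field k] [IsAlgClosed k]
    [Uncountable k] [CommRing A] [IsDomain A] [Algebra k A] [Algebra.FiniteType k A]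
    [Countable ι] (a : ι → A) (ha : ∀ i, a i ≠ 0) :
    ∃ φ : A →ₐ[k] k, ∀ i, φ (a i) ≠ 0 := by
  let g : MvPolynomial ι A →ₐ[A] FractionRing A :=
    MvPolynomial.aeval fun i => (algebraMap A (FractionRing A) (a i))⁻¹
  obtain ⟨M, hM, hgM⟩ := Ideal.exists_le_maximal (RingHom.ker g) (RingHom.ker_ne_top g)
  let L := MvPolynomial ι A ⧸ M
  let : Field L := Ideal.Quotient.field M
  obtain ⟨n, p, hp⟩ := Algebra.FiniteType.iff_quotient_mvPolynomial''.1
    (inferInstance : Algebra.FiniteType k A)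
  let q : MvPolynomial (ι ⊕ Fin n) k →ₐ[k] L :=
    ((Ideal.Quotient.mkₐ k M).comp (MvPolynomial.mapAlgHom p)).comp
      (MvPolynomial.sumAlgEquiv k ι (Fin n)).toAlgHom
  have hq : Function.Surjective q :=
    ((Ideal.Quotient.mkₐ_surjective k M).comp (MvPolynomial.map_surjective _ hp)).comp
      (MvPolynomial.sumAlgEquiv k ι (Fin n)).surjective
  have : Algebra.IsAlgebraic k L :=
    .of_rank_le_aleph0 k L (MvPolynomial.rank_le_aleph0_of_surjective q hq)
  let e : k ≃ₐ[k] L :=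
    .ofBijective (Algebra.ofId k L) IsAlgClosed.algebraMap_bijective_of_isIntegral
  let ψ : A →ₐ[k] L := (Ideal.Quotient.mkₐ k M).comp (Algebra.algHom k A (MvPolynomial ι A))
  refine ⟨(e.symm : L →ₐ[k] k).comp ψ, fun i h => ?_⟩
  have hψ : ψ (a i) = 0 := by simpa using h
  have haM : MvPolynomial.C (a i) ∈ M := Ideal.Quotient.eq_zero_iff_mem.1 hψ
  have hinv : MvPolynomial.X i * MvPolynomial.C (a i) - 1 ∈ M := by
    apply hgM
    have : algebraMap A (FractionRing A) (a i) ≠ 0 := by simpa using ha i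
    simp [g, RingHom.mem_ker, this]
  exact hM.ne_top ((Ideal.eq_top_iff_one M).2 <| by
    simpa using sub_mem (M.mul_mem_left (MvPolynomial.X i) haM) hinv)

/-- An irreducible affine variety over `ℂ` is not the union of countably many
proper closed subsets: given a finitely generated integral `ℂ`-algebra `A` and
countably many nonzero ideals `I n` of `A`, there is a `ℂ`-point of `Spec A`
avoiding all the closed subsets `V(I n)`. -/
theorem exists_point_avoiding_countably_many_subvarieties
    (A : Type*) [CommRing A] [IsDomain A] [Algebra ℂ A]
    (hA : Algebra.FiniteType ℂ A)
    (I : ℕ → Ideal A) (hI : ∀ n, I n ≠ ⊥) :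
    ∃ φ : A →ₐ[ℂ] ℂ, ∀ n, ¬ I n ≤ RingHom.ker (φ : A →+* ℂ) := by
  choose a haI ha using fun n => Submodule.exists_mem_ne_zero_of_ne_bot (hI n)
  have : Uncountable ℂ := by
    rw [← Set.not_countable_univ_iff]
    exact not_countable_complex
  obtain ⟨φ, hφ⟩ := Algebra.FiniteType.exists_algHom_forall_ne_zero (k := ℂ) a ha
  exact ⟨φ, fun n h => hφ n (h (haI n))⟩
end
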